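/- arXiv:1503.07123 — 4 statements merged into one kernel-verified Lean document; each statement's English description precedes it below -/
import Mathlib

section
/- Let Z : ℝ² → ℂ be defined by Z = (z₁ + z₂ + z₃)/3. Then Z is smooth and at every point of ℝ²: (i) ΔZ = −Z, where Δ is the Euclidean Laplacian applied componentwise; (ii) ∇Z · ∇Z = conj(Z) − Z², where ∇Z = (∂ₓZ, ∂ᵧZ) ∈ ℂ² and · is the complex-bilinear dot product; (iii) ∇Z · ∇(conj Z) = (1 − Z·conj(Z))/2; (iv) ∇(conj Z) · ∇(conj Z) = Z − (conj Z)². (These are the defining relations of the deltoid diffusion model with parameter λ = 1, realized as the image of the Euclidean Laplace operator.) -/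
open scoped RealInnerProductSpace
noncomputable section

/-- The plane `ℝ²`. -/
abbrev Plane := EuclideanSpace ℝ (Fin 2)

/-- The three unit vectors `E₁ = (1,0)`, `E₂ = (−1/2, √3/2)`, `E₃ = (−1/2, −√3/2)`. -/
def E : Fin 3 → Plane := fun k =>
  (WithLp.equiv 2 (Fin 2 → ℝ)).symm
    (![![1, 0], ![-(1/2), Real.sqrt 3 / 2], ![-(1/2), -(Real.sqrt 3 / 2)]] k)

/-- `z_k(v) = exp(i⟨v, E_k⟩)`. -/
def z (k : Fin 3) (v : Plane) : ℂ := Complex.exp (Complex.I * ((⟪v, E k⟫ : ℝ) : ℂ))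

/-- `Z = (z₁ + z₂ + z₃)/3`. -/
def Zf (v : Plane) : ℂ := (z 0 v + z 1 v + z 2 v) / 3

/-- The directional derivative of a complex-valued function on the plane. -/
def pd (g : Plane → ℂ) (u : Plane) (v : Plane) : ℂ := fderiv ℝ g v u

/-- The first coordinate vector. -/
def e₀ : Plane := EuclideanSpace.single 0 1
/-- The second coordinate vector. -/
def e₁ : Plane := EuclideanSpace.single 1 1

lemma contDiff_z (k : Fin 3) {n : WithTop ℕ∞} : ContDiff ℝ n (z k) := by
  unfold z
  exact (contDiff_const.mul
    (Complex.ofRealCLM.contDiff.comp (contDiff_id.inner ℝ contDiff_const))).cexp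

lemma differentiableAt_z (k : Fin 3) (v : Plane) : DifferentiableAt ℝ (z k) v :=
  (contDiff_z k (n := 1)).differentiable one_ne_zero v

lemma pd_z (k : Fin 3) (u v : Plane) :
    pd (z k) u v = Complex.I * ((⟪u, E k⟫ : ℝ) : ℂ) * z k v := by
  have hinner : HasFDerivAt (fun w : Plane => (⟪w, E k⟫ : ℝ)) (innerSL ℝ (E k)) v := by
    have h := (innerSL ℝ (E k)).hasFDerivAt (x := v)
    refine h.congr_of_eventuallyEq (Filter.Eventually.of_forall fun w => ?_)
    exact real_inner_comm _ _
  have h := ((Complex.ofRealCLM.hasFDerivAt.comp v hinner).const_mul Complex.I).cexp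
  have hz : HasFDerivAt (z k) _ v := h
  rw [pd, hz.fderiv]
  simp [z, real_inner_comm]
  ring

lemma pd_linear_combination_z (a b c : ℂ) (u v : Plane) :
    pd (fun w => a * z 0 w + b * z 1 w + c * z 2 w) u v
      = a * pd (z 0) u v + b * pd (z 1) u v + c * pd (z 2) u v := by
  have h := (((differentiableAt_z 0 v).hasFDerivAt.const_mul a).add
    ((differentiableAt_z 1 v).hasFDerivAt.const_mul b)).add
    ((differentiableAt_z 2 v).hasFDerivAt.const_mul c)
  have h' : HasFDerivAt (fun w => a * z 0 w + b * z 1 w + c * z 2 w) _ v := h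
  rw [pd, h'.fderiv]
  simp [pd]

lemma pd_conj {g : Plane → ℂ} {v : Plane} (hg : DifferentiableAt ℝ g v) (u : Plane) :
    pd (fun w => (starRingEnd ℂ) (g w)) u v = (starRingEnd ℂ) (pd g u v) := by
  have h : HasFDerivAt (fun w => (starRingEnd ℂ) (g w)) _ v :=
    Complex.conjCLE.toContinuousLinearMap.hasFDerivAt.comp v hg.hasFDerivAt
  rw [pd, h.fderiv]
  simp [pd]

lemma z_mul_z_mul_z (v : Plane) : z 0 v * z 1 v * z 2 v = 1 := by
  simp only [z, ← Complex.exp_add, ← mul_add, ← Complex.ofReal_add, ← inner_add_right]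
  have hE : E 0 + E 1 + E 2 = 0 := by
    ext i
    fin_cases i
    · simp [E]
      ring
    · simp [E]
  simp [hE]

lemma conj_z_mul_z (k : Fin 3) (v : Plane) : (starRingEnd ℂ) (z k v) * z k v = 1 := by
  simp [z, ← Complex.exp_conj, ← Complex.exp_add]

lemma Zf_eq : Zf = fun w => 1 / 3 * z 0 w + 1 / 3 * z 1 w + 1 / 3 * z 2 w := by
  ext w
  simp only [Zf]
  ring

lemma pd_Zf_e₀ : pd Zf e₀ = fun w =>
    Complex.I / 3 * z 0 w + -Complex.I / 6 * z 1 w + -Complex.I / 6 * z 2 w := by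
  ext w
  rw [Zf_eq, pd_linear_combination_z]
  simp [pd_z, e₀, E, EuclideanSpace.inner_single_left]
  ring

lemma pd_Zf_e₁ : pd Zf e₁ = fun w =>
    0 * z 0 w + Complex.I * (Real.sqrt 3 : ℝ) / 6 * z 1 w
      + -(Complex.I * (Real.sqrt 3 : ℝ)) / 6 * z 2 w := by
  ext w
  rw [Zf_eq, pd_linear_combination_z]
  simp [pd_z, e₁, E, EuclideanSpace.inner_single_left]
  ring

/-- The defining relations of the deltoid diffusion model with `λ = 1`:
`Z` is smooth, `ΔZ = −Z`, `∇Z·∇Z = Z̄ − Z²`, `∇Z·∇Z̄ = (1 − ZZ̄)/2`,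
`∇Z̄·∇Z̄ = Z − Z̄²`. -/
theorem deltoid_model_lambda_one :
    ContDiff ℝ (⊤ : ℕ∞) Zf ∧
    ∀ v : Plane,
      (pd (pd Zf e₀) e₀ v + pd (pd Zf e₁) e₁ v = -Zf v) ∧
      (pd Zf e₀ v * pd Zf e₀ v + pd Zf e₁ v * pd Zf e₁ v
        = (starRingEnd ℂ) (Zf v) - (Zf v) ^ 2) ∧
      (pd Zf e₀ v * pd (fun w => (starRingEnd ℂ) (Zf w)) e₀ v
          + pd Zf e₁ v * pd (fun w => (starRingEnd ℂ) (Zf w)) e₁ v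
        = (1 - Zf v * (starRingEnd ℂ) (Zf v)) / 2) ∧
      (pd (fun w => (starRingEnd ℂ) (Zf w)) e₀ v * pd (fun w => (starRingEnd ℂ) (Zf w)) e₀ v
          + pd (fun w => (starRingEnd ℂ) (Zf w)) e₁ v * pd (fun w => (starRingEnd ℂ) (Zf w)) e₁ v
        = Zf v - ((starRingEnd ℂ) (Zf v)) ^ 2) := by
  have hsmooth : ∀ n : WithTop ℕ∞, ContDiff ℝ n Zf := fun n =>
    (((contDiff_z 0).add (contDiff_z 1)).add (contDiff_z 2)).div_const 3
  refine ⟨hsmooth _, fun v => ?_⟩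
  have hdiff : DifferentiableAt ℝ Zf v := (hsmooth 1).differentiable one_ne_zero v
  have hs : ((Real.sqrt 3 : ℝ) : ℂ) ^ 2 = 3 := by
    exact_mod_cast congrArg Complex.ofReal (Real.sq_sqrt (show (0 : ℝ) ≤ 3 by norm_num))
  have hI := Complex.I_sq
  have habc := z_mul_z_mul_z v
  have ha : (starRingEnd ℂ) (z 0 v) = z 1 v * z 2 v := by
    linear_combination z 1 v * z 2 v * conj_z_mul_z 0 v - (starRingEnd ℂ) (z 0 v) * habc
  have hb : (starRingEnd ℂ) (z 1 v) = z 0 v * z 2 v := by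
    linear_combination z 0 v * z 2 v * conj_z_mul_z 1 v - (starRingEnd ℂ) (z 1 v) * habc
  have hc : (starRingEnd ℂ) (z 2 v) = z 0 v * z 1 v := by
    linear_combination z 0 v * z 1 v * conj_z_mul_z 2 v - (starRingEnd ℂ) (z 2 v) * habc
  have hgrad : pd Zf e₀ v * pd Zf e₀ v + pd Zf e₁ v * pd Zf e₁ v
      = (starRingEnd ℂ) (Zf v) - (Zf v) ^ 2 := by
    simp only [pd_Zf_e₀, pd_Zf_e₁, Zf, map_div₀, map_add, map_ofNat, ha, hb, hc]
    generalize z 0 v = a, z 1 v = b, z 2 v = c at *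
    linear_combination ((a - b / 2 - c / 2) ^ 2 + (Real.sqrt 3 : ℝ) ^ 2 / 4 * (b - c) ^ 2) / 9 * hI
      - (b - c) ^ 2 / 36 * hs
  refine ⟨?_, hgrad, ?_, ?_⟩
  · rw [pd_Zf_e₀, pd_Zf_e₁, pd_linear_combination_z, pd_linear_combination_z]
    simp [pd_z, e₀, e₁, E, EuclideanSpace.inner_single_left, Zf]
    linear_combination
      (z 0 v / 3 + (z 1 v + z 2 v) / 12 + (Real.sqrt 3 : ℝ) ^ 2 / 12 * (z 1 v + z 2 v)) * hI
      - (z 1 v + z 2 v) / 12 * hs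
  · rw [pd_conj hdiff, pd_conj hdiff]
    simp only [pd_Zf_e₀, pd_Zf_e₁, Zf, map_div₀, map_add, map_mul, map_neg, map_zero, map_ofNat,
      Complex.conj_I, Complex.conj_ofReal, ha, hb, hc]
    generalize z 0 v = a, z 1 v = b, z 2 v = c at *
    linear_combination -((a - b / 2 - c / 2) * (b * c - a * c / 2 - a * b / 2)
      + (Real.sqrt 3 : ℝ) ^ 2 / 4 * (b - c) * (a * c - a * b)) / 9 * hI
      + (b - c) * (a * c - a * b) / 36 * hs + 1 / 2 * habc
  · rw [pd_conj hdiff, pd_conj hdiff]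
    simpa using congrArg (starRingEnd ℂ) hgrad
end
end

section
/- Let Ω = {v ∈ ℝ² : W(v) ≠ 0} and let f = log(Re W) on the open set Ω. Then for every v ∈ Ω and every u ∈ ℝ²: −Hess f(v)(u,u) ≥ (9/4)·|u|² + (1/6)·⟨∇f(v), u⟩². (This is the curvature-dimension inequality CD(9/4, 8) for the deltoid operator with λ = 4, equivalently CD(3(λ−1)/4, 2λ) for every λ ≥ 1 after multiplying by (λ−1)/3.) -/
open scoped RealInnerProductSpace
noncomputable section

/-- `W = −((z₁−z₂)(z₂−z₃)(z₃−z₁))²`. -/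
def W (v : Plane) : ℂ :=
  -((z 0 v - z 1 v) * (z 1 v - z 2 v) * (z 2 v - z 0 v)) ^ 2

/-- The open set `Ω = {W ≠ 0}`. -/
def Omega : Set Plane := {v | W v ≠ 0}

/-- `f = log (Re W)`. -/
def fdel (v : Plane) : ℝ := Real.log (W v).re

/-- The Hessian (second Fréchet derivative) of a scalar function, as a bilinear form. -/
def Hess (g : Plane → ℝ) (v u w : Plane) : ℝ := fderiv ℝ (fderiv ℝ g) v u w

theorem hasFDerivAt_sum_log_sin {ι V : Type*} [Fintype ι] [NormedAddCommGroup V]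
    [NormedSpace ℝ V] (L : ι → V →L[ℝ] ℝ) {v : V} (hv : ∀ i, Real.sin (L i v) ≠ 0) :
    HasFDerivAt (fun w => ∑ i, Real.log (Real.sin (L i w)))
      (∑ i, (Real.cos (L i v) / Real.sin (L i v)) • L i) v := by
  refine HasFDerivAt.fun_sum fun i _ => ?_
  have h := (((L i).hasFDerivAt (x := v)).sin).log (hv i)
  exact h.congr_fderiv (by rw [smul_smul, div_eq_inv_mul])

theorem hasFDerivAt_sum_cot_smul {ι V : Type*} [Fintype ι] [NormedAddCommGroup V]
    [NormedSpace ℝ V] (L : ι → V →L[ℝ] ℝ) {v : V} (hv : ∀ i, Real.sin (L i v) ≠ 0) :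
    HasFDerivAt (fun w => ∑ i, (Real.cos (L i w) / Real.sin (L i w)) • L i)
      (∑ i, ((-(1 + (Real.cos (L i v) / Real.sin (L i v)) ^ 2)) • L i).smulRight (L i)) v := by
  refine HasFDerivAt.fun_sum fun i _ => ?_
  have hd : HasDerivAt (fun t => Real.cos t / Real.sin t)
      (-(1 + (Real.cos (L i v) / Real.sin (L i v)) ^ 2)) (L i v) := by
    refine ((Real.hasDerivAt_cos (L i v)).fun_div
      (Real.hasDerivAt_sin (L i v)) (hv i)).congr_deriv ?_
    have := hv i
    field_simp
    ring
  exact (hd.comp_hasFDerivAt v (L i).hasFDerivAt).smul_const (L i)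

theorem eventually_forall_sin_ne_zero {ι V : Type*} [Fintype ι] [NormedAddCommGroup V]
    [NormedSpace ℝ V] (L : ι → V →L[ℝ] ℝ) {v : V} (hv : ∀ i, Real.sin (L i v) ≠ 0) :
    ∀ᶠ w in nhds v, ∀ i, Real.sin (L i w) ≠ 0 :=
  Filter.eventually_all.2 fun i =>
    (Real.continuous_sin.comp (L i).continuous).continuousAt.eventually_ne (hv i)

theorem exp_I_mul_sub_exp_I_mul (x y : ℂ) :
    Complex.exp (Complex.I * x) - Complex.exp (Complex.I * y) =
      2 * Complex.I * Complex.sin ((x - y) / 2) * Complex.exp (Complex.I * ((x + y) / 2)) := by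
  have hx : Complex.exp (Complex.I * x) = Complex.exp ((x - y) / 2 * Complex.I) *
      Complex.exp (Complex.I * ((x + y) / 2)) := by
    rw [← Complex.exp_add]; ring_nf
  have hy : Complex.exp (Complex.I * y) = Complex.exp (-((x - y) / 2) * Complex.I) *
      Complex.exp (Complex.I * ((x + y) / 2)) := by
    rw [← Complex.exp_add]; ring_nf
  rw [hx, hy, Complex.sin]
  linear_combination (-(Complex.exp (-((x - y) / 2) * Complex.I) -
    Complex.exp ((x - y) / 2 * Complex.I)) * Complex.exp (Complex.I * ((x + y) / 2))) *
    Complex.I_sq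

/-- The half-differences `⟨·, E_k - E_{k+1}⟩ / 2`. -/
def halfDiff (k : Fin 3) : Plane →L[ℝ] ℝ := innerSL ℝ ((1 / 2 : ℝ) • (E k - E (k + 1)))

theorem halfDiff_apply (k : Fin 3) (v : Plane) :
    halfDiff k v = (⟪v, E k⟫ - ⟪v, E (k + 1)⟫) / 2 := by
  rw [halfDiff, innerSL_apply_apply, real_inner_comm, inner_smul_right, inner_sub_right]
  ring

theorem sum_inner_E (v : Plane) : ⟪v, E 0⟫ + ⟪v, E 1⟫ + ⟪v, E 2⟫ = 0 := by
  simp [E, PiLp.inner_apply, Fin.sum_univ_two]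
  ring

theorem sum_halfDiff_sq (u : Plane) : ∑ k, halfDiff k u ^ 2 = 9 / 8 * ‖u‖ ^ 2 := by
  have h3 : Real.sqrt 3 ^ 2 = 3 := Real.sq_sqrt (by norm_num)
  rw [EuclideanSpace.real_norm_sq_eq]
  simp only [Fin.sum_univ_three, Fin.sum_univ_two, halfDiff_apply]
  simp [E, PiLp.inner_apply, Fin.sum_univ_two]
  linear_combination (3 / 8 * u 1 ^ 2) * h3

theorem W_eq (v : Plane) : W v = ((64 * (∏ k, Real.sin (halfDiff k v)) ^ 2 : ℝ) : ℂ) := by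
  have hs : ((⟪v, E 0⟫ : ℝ) : ℂ) + (⟪v, E 1⟫ : ℝ) + (⟪v, E 2⟫ : ℝ) = 0 :=
    mod_cast sum_inner_E v
  have he : Complex.exp (Complex.I * ((((⟪v, E 0⟫ : ℝ) : ℂ) + (⟪v, E 1⟫ : ℝ)) / 2)) *
      Complex.exp (Complex.I * ((((⟪v, E 1⟫ : ℝ) : ℂ) + (⟪v, E 2⟫ : ℝ)) / 2)) *
      Complex.exp (Complex.I * ((((⟪v, E 2⟫ : ℝ) : ℂ) + (⟪v, E 0⟫ : ℝ)) / 2)) = 1 := by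
    rw [← Complex.exp_add, ← Complex.exp_add, Complex.exp_eq_one_iff]
    exact ⟨0, by push_cast; linear_combination Complex.I * hs⟩
  have h2 : (1 : Fin 3) + 1 = 2 := rfl
  have h0 : (2 : Fin 3) + 1 = 0 := rfl
  simp only [Fin.prod_univ_three, halfDiff_apply, zero_add, h2, h0]
  simp only [W, z, exp_I_mul_sub_exp_I_mul]
  push_cast
  generalize Complex.sin _ = a at *
  generalize Complex.sin _ = b at *
  generalize Complex.sin _ = c at *
  generalize Complex.exp _ = p at *
  generalize Complex.exp _ = q at *
  generalize Complex.exp _ = r at *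
  have hI : Complex.I ^ 6 = -1 := by
    linear_combination (Complex.I ^ 4 - Complex.I ^ 2 + 1) * Complex.I_sq
  linear_combination (-64 * (a * b * c) ^ 2 * (p * q * r) ^ 2) * hI +
    (64 * (a * b * c) ^ 2 * (p * q * r + 1)) * he

theorem mem_Omega_iff (v : Plane) : v ∈ Omega ↔ ∀ k, Real.sin (halfDiff k v) ≠ 0 := by
  simp [Omega, W_eq, Finset.prod_eq_zero_iff, -Complex.ofReal_prod, -Complex.ofReal_mul,
    -Complex.ofReal_pow]

theorem fdel_eq {v : Plane} (hv : ∀ k, Real.sin (halfDiff k v) ≠ 0) :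
    fdel v = Real.log 64 + (2 : ℝ) • ∑ k, Real.log (Real.sin (halfDiff k v)) := by
  have hp : ∏ k, Real.sin (halfDiff k v) ≠ 0 := Finset.prod_ne_zero_iff.2 fun k _ => hv k
  rw [fdel, W_eq, Complex.ofReal_re, Real.log_mul (by norm_num) (pow_ne_zero 2 hp),
    Real.log_pow, Real.log_prod fun k _ => hv k]
  simp

theorem fderiv_fdel {v : Plane} (hv : ∀ k, Real.sin (halfDiff k v) ≠ 0) :
    fderiv ℝ fdel v =
      (2 : ℝ) • ∑ k, (Real.cos (halfDiff k v) / Real.sin (halfDiff k v)) • halfDiff k :=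
  ((((hasFDerivAt_sum_log_sin halfDiff hv).const_smul (2 : ℝ)).const_add
    (Real.log 64)).congr_of_eventuallyEq
      ((eventually_forall_sin_ne_zero halfDiff hv).mono fun _ => fdel_eq)).fderiv

theorem Hess_fdel {v : Plane} (hv : ∀ k, Real.sin (halfDiff k v) ≠ 0) (u : Plane) :
    Hess fdel v u u = -2 * ∑ k,
      (1 + (Real.cos (halfDiff k v) / Real.sin (halfDiff k v)) ^ 2) * halfDiff k u ^ 2 := by
  have h := ((hasFDerivAt_sum_cot_smul halfDiff hv).const_smul (2 : ℝ)).congr_of_eventuallyEq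
    ((eventually_forall_sin_ne_zero halfDiff hv).mono fun _ => fderiv_fdel)
  rw [Hess, h.fderiv]
  simp only [Fin.sum_univ_three, smul_apply, add_apply,
    ContinuousLinearMap.smulRight_apply, smul_eq_mul]
  ring

/-- The curvature-dimension inequality `CD(9/4, 8)` for the deltoid model with `λ = 4`:
`−Hess f ≥ (9/4)·Id + (1/6)·∇f ⊗ ∇f` on `Ω`. -/
theorem deltoid_CD_nine_fourths :
    ∀ v ∈ Omega, ∀ u : Plane,
      -Hess fdel v u u ≥ (9/4) * ‖u‖ ^ 2 + (1/6) * ⟪gradient fdel v, u⟫ ^ 2 := by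
  intro v hv u
  rw [mem_Omega_iff] at hv
  have hn := sum_halfDiff_sq u
  rw [Hess_fdel hv, gradient, InnerProductSpace.toDual_symm_apply, fderiv_fdel hv]
  simp only [Fin.sum_univ_three, smul_apply, add_apply,
    smul_eq_mul] at hn ⊢
  set c : Fin 3 → ℝ := fun k => Real.cos (halfDiff k v) / Real.sin (halfDiff k v) * halfDiff k u
  nlinarith [sq_nonneg (c 0 - c 1), sq_nonneg (c 1 - c 2), sq_nonneg (c 2 - c 0)]
end
end

section
/- Let Ω = {v ∈ ℝ² : W(v) ≠ 0} and f = log(Re W) on Ω. The constant 9/4 in the inequality −Hess f ≥ (9/4)Id + (1/6)∇f ⊗ ∇f is optimal: for every ε > 0 there exist a point v ∈ Ω and a unit vector u ∈ ℝ² such that −Hess f(v)(u,u) − (1/6)·⟨∇f(v), u⟩² < 9/4 + ε. -/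
open scoped RealInnerProductSpace
noncomputable section

/-- The second coordinate direction. -/
def vert : Plane := EuclideanSpace.single 1 1

lemma W_smul_vert (t : ℝ) :
    W (t • vert) =
      ((256 * Real.sin (√3 / 4 * t) ^ 6 * Real.cos (√3 / 4 * t) ^ 2 : ℝ) : ℂ) := by
  have h0 : (⟪t • vert, E 0⟫ : ℝ) = 0 := by
    simp [vert, E, PiLp.inner_apply]
  have h1 : (⟪t • vert, E 1⟫ : ℝ) = 2 * (√3 / 4 * t) := by
    simp [vert, E, PiLp.inner_apply]
    ring
  have h2 : (⟪t • vert, E 2⟫ : ℝ) = -(2 * (√3 / 4 * t)) := by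
    simp [vert, E, PiLp.inner_apply]
    ring
  simp only [W, z, h0, h1, h2]
  generalize √3 / 4 * t = q
  have e1 : Complex.exp (Complex.I * ((2 * q : ℝ) : ℂ)) =
      (Complex.cos q + Complex.sin q * Complex.I) ^ 2 := by
    rw [← Complex.exp_mul_I, ← Complex.exp_nat_mul]
    congr 1
    push_cast
    ring
  have e2 : Complex.exp (Complex.I * ((-(2 * q) : ℝ) : ℂ)) =
      (Complex.cos q - Complex.sin q * Complex.I) ^ 2 := by
    rw [sub_eq_add_neg (Complex.cos _), ← neg_mul (Complex.sin _), ← Complex.sin_neg, ← Complex.cos_neg, ← Complex.exp_mul_I,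
      ← Complex.exp_nat_mul]
    congr 1
    push_cast
    ring
  rw [e1, e2]
  push_cast
  simp only [mul_zero, Complex.exp_zero]
  have hI := Complex.I_sq
  have hsc := Complex.sin_sq_add_cos_sq (q : ℂ)
  generalize Complex.sin q = s at *
  generalize Complex.cos q = c at *
  have hprod : (1 - (c + s * Complex.I) ^ 2) * ((c + s * Complex.I) ^ 2 - (c - s * Complex.I) ^ 2) *
      ((c - s * Complex.I) ^ 2 - 1) = -16 * Complex.I * s ^ 3 * c := by
    have ha : 1 - (c + s * Complex.I) ^ 2 = -2 * s * Complex.I * (c + s * Complex.I) := by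
      linear_combination (-1 : ℂ) * hsc + s ^ 2 * hI
    have hb : (c - s * Complex.I) ^ 2 - 1 = -2 * s * Complex.I * (c - s * Complex.I) := by
      linear_combination hsc - s ^ 2 * hI
    have hc : (c + s * Complex.I) * (c - s * Complex.I) = 1 := by
      linear_combination hsc - s ^ 2 * hI
    rw [ha, hb]
    linear_combination (16 * s ^ 3 * c * Complex.I ^ 3) * hc + 16 * s ^ 3 * c * Complex.I * hI
  rw [hprod]
  linear_combination (-256 * s ^ 6 * c ^ 2) * hI

lemma contDiff_W_re : ContDiff ℝ 2 fun v => (W v).re := by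
  have hz (k : Fin 3) : ContDiff ℝ 2 (z k) := by
    unfold z
    exact (contDiff_const.mul
      (Complex.ofRealCLM.contDiff.comp (contDiff_id.inner ℝ contDiff_const))).cexp
  exact Complex.reCLM.contDiff.comp
    (((((hz 0).sub (hz 1)).mul ((hz 1).sub (hz 2))).mul ((hz 2).sub (hz 0))).pow 2).neg

lemma fdel_contDiffAt {v : Plane} (hv : (W v).re ≠ 0) : ContDiffAt ℝ 2 fdel v :=
  contDiff_W_re.contDiffAt.log hv

lemma W_smul_vert_re_ne_zero {t : ℝ} (hs : Real.sin (√3 / 4 * t) ≠ 0)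
    (hc : Real.cos (√3 / 4 * t) ≠ 0) : (W (t • vert)).re ≠ 0 := by
  rw [W_smul_vert, Complex.ofReal_re]
  positivity

lemma fderiv_fdel_smul_vert {t : ℝ} (hs : Real.sin (√3 / 4 * t) ≠ 0)
    (hc : Real.cos (√3 / 4 * t) ≠ 0) :
    fderiv ℝ fdel (t • vert) vert =
      √3 / 4 * (6 * (Real.cos (√3 / 4 * t) / Real.sin (√3 / 4 * t)) -
        2 * (Real.sin (√3 / 4 * t) / Real.cos (√3 / 4 * t))) := by
  have hline : HasDerivAt (fun t : ℝ => t • vert) vert t := by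
    simpa using (hasDerivAt_id t).smul_const vert
  have hf : HasDerivAt (fun t : ℝ => fdel (t • vert)) (fderiv ℝ fdel (t • vert) vert) t :=
    HasFDerivAt.comp_hasDerivAt (f := fun t : ℝ => t • vert) (l := fdel) t
      ((fdel_contDiffAt (W_smul_vert_re_ne_zero hs hc)).differentiableAt
        (by norm_num)).hasFDerivAt hline
  have heq : (fun t : ℝ => fdel (t • vert)) = fun t =>
      Real.log (256 * Real.sin (√3 / 4 * t) ^ 6 * Real.cos (√3 / 4 * t) ^ 2) := by
    funext t
    rw [fdel, W_smul_vert, Complex.ofReal_re]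
  rw [heq] at hf
  have hq : HasDerivAt (fun t : ℝ => √3 / 4 * t) (√3 / 4) t := by
    simpa using (hasDerivAt_id t).const_mul (√3 / 4)
  have hg := (((hq.sin.pow 6).const_mul 256).mul (hq.cos.pow 2)).log (by simp [hs, hc])
  rw [hf.unique hg]
  simp only [Pi.mul_apply, Pi.pow_apply]
  generalize Real.sin (√3 / 4 * t) = s at *
  generalize Real.cos (√3 / 4 * t) = c at *
  field_simp
  ring

lemma hess_fdel_smul_vert {t : ℝ} (hs : Real.sin (√3 / 4 * t) ≠ 0)
    (hc : Real.cos (√3 / 4 * t) ≠ 0) :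
    Hess fdel (t • vert) vert vert =
      -(3 / 16 * (6 / Real.sin (√3 / 4 * t) ^ 2 + 2 / Real.cos (√3 / 4 * t) ^ 2)) := by
  have hline : HasDerivAt (fun t : ℝ => t • vert) vert t := by
    simpa using (hasDerivAt_id t).smul_const vert
  have hd : DifferentiableAt ℝ (fderiv ℝ fdel) (t • vert) :=
    ((fdel_contDiffAt (W_smul_vert_re_ne_zero hs hc)).fderiv_right
      (m := 1) (by norm_num)).differentiableAt (by norm_num)
  have hf : HasDerivAt (fun t : ℝ => fderiv ℝ fdel (t • vert) vert)
      (Hess fdel (t • vert) vert vert) t := by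
    have h : HasDerivAt (fun t : ℝ => fderiv ℝ fdel (t • vert))
        (fderiv ℝ (fderiv ℝ fdel) (t • vert) vert) t :=
      HasFDerivAt.comp_hasDerivAt (f := fun t : ℝ => t • vert) (l := fderiv ℝ fdel) t
        hd.hasFDerivAt hline
    simpa only [Hess, map_zero, add_zero] using h.clm_apply (hasDerivAt_const t vert)
  have hq : HasDerivAt (fun t : ℝ => √3 / 4 * t) (√3 / 4) t := by
    simpa using (hasDerivAt_id t).const_mul (√3 / 4)
  have heq : (fun t : ℝ => fderiv ℝ fdel (t • vert) vert) =ᶠ[nhds t] fun t =>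
      √3 / 4 * (6 * (Real.cos (√3 / 4 * t) / Real.sin (√3 / 4 * t)) -
        2 * (Real.sin (√3 / 4 * t) / Real.cos (√3 / 4 * t))) := by
    filter_upwards [hq.sin.continuousAt.eventually_ne hs, hq.cos.continuousAt.eventually_ne hc]
      with x hx hx' using fderiv_fdel_smul_vert hx hx'
  have hg := (((hq.cos.div hq.sin hs).const_mul 6).sub
    ((hq.sin.div hq.cos hc).const_mul 2)).const_mul (√3 / 4)
  rw [(hf.congr_of_eventuallyEq heq.symm).unique hg]
  have h3 : √3 ^ 2 = 3 := Real.sq_sqrt (by norm_num)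
  have hsc := Real.sin_sq_add_cos_sq (√3 / 4 * t)
  generalize Real.sin (√3 / 4 * t) = s at *
  generalize Real.cos (√3 / 4 * t) = c at *
  have h1 : (-s * (√3 / 4) * s - c * (c * (√3 / 4))) = -(√3 / 4) := by
    linear_combination (-(√3 / 4)) * hsc
  have h2 : (c * (√3 / 4) * c - s * (-s * (√3 / 4))) = √3 / 4 := by
    linear_combination (√3 / 4) * hsc
  rw [h1, h2]
  field_simp
  rw [h3]
  ring

lemma neg_hess_sub_gradient_sq_smul_vert {t : ℝ} (hs : Real.sin (√3 / 4 * t) ≠ 0)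
    (hc : Real.cos (√3 / 4 * t) ≠ 0) :
    -Hess fdel (t • vert) vert vert - (1/6) * ⟪gradient fdel (t • vert), vert⟫ ^ 2 =
      9 / 4 + Real.tan (√3 / 4 * t) ^ 2 / 4 := by
  have hgrad : ⟪gradient fdel (t • vert), vert⟫ = fderiv ℝ fdel (t • vert) vert := by
    simp [gradient]
  rw [hgrad, fderiv_fdel_smul_vert hs hc, hess_fdel_smul_vert hs hc, Real.tan_eq_sin_div_cos,
    mul_pow, div_pow, Real.sq_sqrt (by norm_num)]
  have hsc := Real.sin_sq_add_cos_sq (√3 / 4 * t)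
  generalize Real.sin (√3 / 4 * t) = s at *
  generalize Real.cos (√3 / 4 * t) = c at *
  have h1 : 6 / s ^ 2 + 2 / c ^ 2 = 8 + 6 * (c / s) ^ 2 + 2 * (s / c) ^ 2 := by
    field_simp
    linear_combination (-(6 * c ^ 2 + 2 * s ^ 2)) * hsc
  have h2 : c / s * (s / c) = 1 := by field_simp
  rw [h1]
  linear_combination (3 / 4 : ℝ) * h2

/-- Optimality of the constant `9/4` in the inequality
`−Hess f ≥ (9/4)·Id + (1/6)·∇f ⊗ ∇f` on `Ω`. -/
theorem deltoid_CD_nine_fourths_optimal :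
    ∀ ε : ℝ, 0 < ε → ∃ v ∈ Omega, ∃ u : Plane, ‖u‖ = 1 ∧
      -Hess fdel v u u - (1/6) * ⟪gradient fdel v, u⟫ ^ 2 < 9/4 + ε := by
  intro ε hε
  have htan : Filter.Tendsto (fun t : ℝ => Real.tan (√3 / 4 * t) ^ 2 / 4)
      (nhdsWithin 0 (Set.Ioi 0)) (nhds 0) := by
    have hq : ContinuousAt (fun t : ℝ => √3 / 4 * t) 0 := by fun_prop
    have : ContinuousAt (fun t : ℝ => Real.tan (√3 / 4 * t) ^ 2 / 4) 0 :=
      ((ContinuousAt.comp' (Real.continuousAt_tan.2 (by simp)) hq).pow 2).div_const 4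
    simpa using this.tendsto.mono_left nhdsWithin_le_nhds
  obtain ⟨t, ht, ht0, ht1⟩ := ((htan.eventually_lt_const hε).and
    (Ioo_mem_nhdsGT (zero_lt_one' ℝ))).exists
  have h3 : √3 < 4 := by
    rw [Real.sqrt_lt' (by norm_num)]
    norm_num
  have hq0 : 0 < √3 / 4 * t := by positivity
  have hq1 : √3 / 4 * t < 1 := by nlinarith
  have hs := (Real.sin_pos_of_pos_of_lt_pi hq0 (by linarith [Real.pi_gt_three])).ne'
  have hc := (Real.cos_pos_of_mem_Ioo (x := √3 / 4 * t)
    ⟨by linarith [Real.pi_gt_three], by linarith [Real.pi_gt_three]⟩).ne'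
  refine ⟨t • vert, fun h => W_smul_vert_re_ne_zero hs hc (by rw [h, Complex.zero_re]), vert,
    by simp [vert], ?_⟩
  rw [neg_hess_sub_gradient_sq_smul_vert hs hc]
  linarith
end
end

section
/- In the polynomial ring ℂ[Z, Z̄] in two independent variables Z and Z̄, let P = (1/4)(1 − Z·Z̄)² − (Z̄ − Z²)(Z − Z̄²). Then the following two 'boundary equation' identities hold: (Z̄ − Z²)·∂_Z P + (1/2)(1 − Z·Z̄)·∂_Z̄ P = −3·Z·P, and (Z − Z̄²)·∂_Z̄ P + (1/2)(1 − Z·Z̄)·∂_Z P = −3·Z̄·P. (These express that Γ(Z, log P) = −3Z and Γ(Z̄, log P) = −3Z̄ for the carré du champ Γ of the deltoid operator, given by Γ(Z,Z) = Z̄ − Z², Γ(Z̄,Z̄) = Z − Z̄², Γ(Z,Z̄) = (1 − ZZ̄)/2.) -/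
open MvPolynomial
noncomputable section

/-- The variable `Z` in `ℂ[Z, Z̄]`. -/
def Zv : MvPolynomial (Fin 2) ℂ := X 0

/-- The variable `Z̄` in `ℂ[Z, Z̄]`. -/
def Zbv : MvPolynomial (Fin 2) ℂ := X 1

/-- `P = (1/4)(1 − Z·Z̄)² − (Z̄ − Z²)(Z − Z̄²)`. -/
def Pdel : MvPolynomial (Fin 2) ℂ :=
  C (1/4) * (1 - Zv * Zbv) ^ 2 - (Zbv - Zv ^ 2) * (Zv - Zbv ^ 2)

/-- The boundary equations `Γ(Z, log P) = −3Z` and `Γ(Z̄, log P) = −3Z̄` for the deltoid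
operator, written as polynomial identities. -/
theorem deltoid_boundary_equation :
    (Zbv - Zv ^ 2) * pderiv 0 Pdel + C (1/2) * (1 - Zv * Zbv) * pderiv 1 Pdel
        = -(3 : MvPolynomial (Fin 2) ℂ) * Zv * Pdel ∧
    (Zv - Zbv ^ 2) * pderiv 1 Pdel + C (1/2) * (1 - Zv * Zbv) * pderiv 0 Pdel
        = -(3 : MvPolynomial (Fin 2) ℂ) * Zbv * Pdel := by
  have hC : (C (1/2) : MvPolynomial (Fin 2) ℂ) * 2 = 1 := by
    rw [← map_ofNat C 2, ← C_mul]
    norm_num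
  have hC4 : (C (1/4) : MvPolynomial (Fin 2) ℂ) = C (1/2) ^ 2 := by
    rw [← C_pow]
    norm_num
  have h0 : pderiv 0 Pdel = -C (1/2) * (1 - Zv * Zbv) * Zbv + 2 * Zv * (Zv - Zbv ^ 2)
      - (Zbv - Zv ^ 2) := by
    simp [Pdel, Zv, Zbv, pderiv_X, Derivation.leibniz_pow, -one_div, hC4]
    grind
  have h1 : pderiv 1 Pdel = -C (1/2) * (1 - Zv * Zbv) * Zv + 2 * Zbv * (Zbv - Zv ^ 2)
      - (Zv - Zbv ^ 2) := by
    simp [Pdel, Zv, Zbv, pderiv_X, Derivation.leibniz_pow, -one_div, hC4]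
    grind
  rw [h0, h1, Pdel, hC4]
  generalize (C (1/2) : MvPolynomial (Fin 2) ℂ) = h at hC
  constructor <;> grind
end
end
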